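/- Let V be a dense open subset of ℝ and let f : ℝ → ℝ be C^∞ on V. Then there exist g, h : ℝ → ℝ, both C^∞ on ℝ, such that coz g = V (exactly), f(x)·g(x) = h(x) for every x ∈ V, h(x) = 0 for every x ∉ V, and moreover every iterated derivative of g and of h vanishes at every point of ℝ \ V. -/

import Mathlib

noncomputable section

/-- The cozero set of a function. -/
def coz (f : ℝ → ℝ) : Set ℝ := {x | f x ≠ 0}

open Set Function Filter Topology
open scoped ContDiff

section Auxiliary

variable {E : Type*} [NormedAddCommGroup E] [NormedSpace ℝ E]

/-- An open set is the union of the supports of countably many smooth nonnegative bump functions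
whose topological supports are compact subsets of it. -/
theorem IsOpen.exists_seq_contDiff_tsupport_subset [FiniteDimensional ℝ E] {s : Set E}
    (hs : IsOpen s) :
    ∃ φ : ℕ → E → ℝ, (∀ n, ContDiff ℝ ∞ (φ n)) ∧ (∀ n, HasCompactSupport (φ n)) ∧
      (∀ n, tsupport (φ n) ⊆ s) ∧ (∀ n x, 0 ≤ φ n x) ∧ ∀ x ∈ s, ∃ n, 0 < φ n x := by
  rcases eq_empty_or_nonempty s with rfl | ⟨x₀, hx₀⟩
  · exact ⟨fun _ _ => 0, fun _ => contDiff_const, fun _ => HasCompactSupport.zero,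
      fun _ => by simp [tsupport], fun _ _ => le_rfl, fun _ h => h.elim⟩
  have hbump (x : s) := exists_contDiff_tsupport_subset (n := ⊤) (hs.mem_nhds x.2)
  choose b hbs hbc hb hbr hb1 using hbump
  obtain ⟨T, hTc, hT⟩ := TopologicalSpace.isOpen_iUnion_countable (fun x : s => support (b x))
    fun x => (hb x).continuous.isOpen_support
  have hcover : ∀ x ∈ s, ∃ i ∈ T, b i x ≠ 0 := by
    intro x hx
    have : x ∈ ⋃ i ∈ T, support (b i) := by
      rw [hT]
      exact mem_iUnion_of_mem ⟨x, hx⟩ (by simp [hb1 ⟨x, hx⟩])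
    simpa only [mem_iUnion, exists_prop, mem_support] using this
  obtain ⟨i₀, hi₀, -⟩ := hcover x₀ hx₀
  obtain ⟨e, rfl⟩ := hTc.exists_eq_range ⟨i₀, hi₀⟩
  have hnonneg (i : s) (x : E) : 0 ≤ b i x := (hbr i (mem_range_self x)).1
  refine ⟨fun n => b (e n), fun n => hb _, fun n => hbc _, fun n => hbs _,
    fun n => hnonneg _, fun x hx => ?_⟩
  obtain ⟨_, ⟨n, rfl⟩, hn⟩ := hcover x hx
  exact ⟨n, (hnonneg _ x).lt_of_ne' hn⟩

/-- Countably many sequences of nonnegative reals can be made summable by a common sequence of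
positive weights. -/
theorem exists_pos_forall_summable_mul (R : ℕ → ℕ → ℝ) (hR : ∀ n k, 0 ≤ R n k) :
    ∃ r : ℕ → ℝ, (∀ n, 0 < r n) ∧ ∀ k, Summable fun n => r n * R n k := by
  have hpos (n : ℕ) : 0 < 1 + ∑ j ∈ Finset.range (n + 1), R n j :=
    add_pos_of_pos_of_nonneg one_pos (Finset.sum_nonneg fun j _ => hR n j)
  refine ⟨fun n => (1 / 2) ^ n / (1 + ∑ j ∈ Finset.range (n + 1), R n j),
    fun n => div_pos (by positivity) (hpos n), fun k => ?_⟩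
  refine Summable.of_norm_bounded_eventually_nat summable_geometric_two ?_
  filter_upwards [eventually_ge_atTop k] with n hn
  have hle : R n k ≤ 1 + ∑ j ∈ Finset.range (n + 1), R n j :=
    (Finset.single_le_sum (f := R n) (fun j _ => hR n j)
      (Finset.mem_range.2 (Nat.lt_succ_of_le hn))).trans (by linarith)
  rw [Real.norm_of_nonneg (mul_nonneg (div_pos (by positivity) (hpos n)).le (hR n k)),
    div_mul_eq_mul_div, div_le_iff₀ (hpos n)]
  gcongr

theorem HasCompactSupport.exists_norm_iteratedFDeriv_le {φ : E → ℝ} (hc : HasCompactSupport φ)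
    (hφ : ContDiff ℝ ∞ φ) (k : ℕ) : ∃ R, 0 ≤ R ∧ ∀ x, ‖_root_.iteratedFDeriv ℝ k φ x‖ ≤ R := by
  obtain ⟨R, hR⟩ := (hc.iteratedFDeriv k).exists_bound_of_continuous
    (hφ.continuous_iteratedFDeriv (mod_cast le_top))
  exact ⟨R, (norm_nonneg _).trans (hR 0), hR⟩

theorem ContDiffOn.contDiff_mul_of_tsupport_subset {s : Set E} {f φ : E → ℝ} {n : WithTop ℕ∞}
    (hs : IsOpen s) (hf : ContDiffOn ℝ n f s) (hφ : ContDiff ℝ n φ) (h : tsupport φ ⊆ s) :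
    ContDiff ℝ n (f * φ) := by
  rw [contDiff_iff_contDiffAt]
  intro x
  by_cases hx : x ∈ tsupport φ
  · exact (hf.contDiffAt (hs.mem_nhds (h hx))).mul hφ.contDiffAt
  · refine (contDiffAt_const (c := (0 : ℝ))).congr_of_eventuallyEq ?_
    filter_upwards [notMem_tsupport_iff_eventuallyEq.1 hx] with y hy
    simp [hy]

/-- A weighted series of smooth functions with summable derivative bounds is smooth, and all its
derivatives vanish outside any set containing the topological supports of the terms. -/
theorem contDiff_tsum_smul_and_iteratedFDeriv_eq_zero {s : Set E} {F : ℕ → E → ℝ} {r : ℕ → ℝ}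
    {v : ℕ → ℕ → ℝ} (hF : ∀ n, ContDiff ℝ ∞ (F n)) (hs : ∀ n, tsupport (F n) ⊆ s)
    (hr : ∀ n, 0 ≤ r n) (hv : ∀ k, Summable fun n => r n * v n k)
    (hle : ∀ n k x, ‖iteratedFDeriv ℝ k (F n) x‖ ≤ v n k) :
    ContDiff ℝ ∞ (fun x => ∑' n, (r n • F n) x) ∧
      ∀ k, ∀ x ∉ s, iteratedFDeriv ℝ k (fun x => ∑' n, (r n • F n) x) x = 0 := by
  have hsmul (n k : ℕ) (x : E) :
      iteratedFDeriv ℝ k (r n • F n) x = r n • iteratedFDeriv ℝ k (F n) x :=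
    iteratedFDeriv_const_smul_apply ((hF n).contDiffAt.of_le (mod_cast le_top))
  have hcd (n : ℕ) : ContDiff ℝ ∞ (r n • F n) := (hF n).const_smul (r n)
  have hbound (k n : ℕ) (x : E) : ‖iteratedFDeriv ℝ k (r n • F n) x‖ ≤ r n * v n k := by
    rw [hsmul, norm_smul, Real.norm_of_nonneg (hr n)]
    exact mul_le_mul_of_nonneg_left (hle n k x) (hr n)
  refine ⟨contDiff_tsum hcd (fun k _ => hv k) fun k n x _ => hbound k n x, fun k x hx => ?_⟩
  rw [iteratedFDeriv_tsum_apply hcd (fun k _ => hv k) (fun k n x _ => hbound k n x)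
    (show (k : ℕ∞) ≤ ⊤ from le_top)]
  have hzero (n : ℕ) : iteratedFDeriv ℝ k (r n • F n) x = 0 := by
    rw [hsmul, notMem_support.1 fun h => hx (hs n (support_iteratedFDeriv_subset k h)), smul_zero]
  simp only [hzero, tsum_zero]

end Auxiliary

/-- For a dense open `V ⊆ ℝ` and `f` which is `C^∞` on `V`, there are
`g, h` which are `C^∞` on `ℝ` with `coz g = V`, `f * g = h` on `V`, `h = 0` off `V`,
and all iterated derivatives of `g` and `h` vanish on `ℝ \ V`. -/
theorem stmt1 (V : Set ℝ) (hV : IsOpen V) (hVd : Dense V)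
    (f : ℝ → ℝ) (hf : ContDiffOn ℝ (⊤ : ℕ∞) f V) :
    ∃ g h : ℝ → ℝ, ContDiff ℝ (⊤ : ℕ∞) g ∧ ContDiff ℝ (⊤ : ℕ∞) h ∧
      coz g = V ∧ (∀ x ∈ V, f x * g x = h x) ∧ (∀ x ∉ V, h x = 0) ∧
      (∀ n : ℕ, ∀ x ∉ V, iteratedDeriv n g x = 0 ∧ iteratedDeriv n h x = 0) := by
  obtain ⟨φ, hφ, hφc, hφV, hφ0, hφpos⟩ := hV.exists_seq_contDiff_tsupport_subset
  have hfφ (n : ℕ) : ContDiff ℝ ∞ (f * φ n) :=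
    hf.contDiff_mul_of_tsupport_subset hV (hφ n) (hφV n)
  have hfφV (n : ℕ) : tsupport (f * φ n) ⊆ V := tsupport_mul_subset_right.trans (hφV n)
  choose A hA0 hA using fun n => (hφc n).exists_norm_iteratedFDeriv_le (hφ n)
  choose B hB0 hB using fun n =>
    (HasCompactSupport.mul_left (f := f) (hφc n)).exists_norm_iteratedFDeriv_le (hfφ n)
  obtain ⟨r, hr, hsum⟩ := exists_pos_forall_summable_mul (fun n k => A n k + B n k)
    fun n k => add_nonneg (hA0 n k) (hB0 n k)
  obtain ⟨hg, hg'⟩ := contDiff_tsum_smul_and_iteratedFDeriv_eq_zero hφ hφV (fun n => (hr n).le)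
    hsum fun n k x => (hA n k x).trans (le_add_of_nonneg_right (hB0 n k))
  obtain ⟨hh, hh'⟩ := contDiff_tsum_smul_and_iteratedFDeriv_eq_zero hfφ hfφV
    (fun n => (hr n).le) hsum fun n k x => (hB n k x).trans (le_add_of_nonneg_left (hA0 n k))
  have hoff (n : ℕ) (x : ℝ) (hx : x ∉ V) : φ n x = 0 :=
    image_eq_zero_of_notMem_tsupport fun h => hx (hφV n h)
  have hterm (n : ℕ) (x : ℝ) : 0 ≤ (r n • φ n) x := mul_nonneg (hr n).le (hφ0 n x)
  have hsummable (x : ℝ) : Summable fun n => (r n • φ n) x := by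
    refine Summable.of_nonneg_of_le (fun n => hterm n x) (fun n => ?_) (hsum 0)
    have hφA : φ n x ≤ A n 0 := (le_abs_self _).trans (by simpa using hA n 0 x)
    exact mul_le_mul_of_nonneg_left (hφA.trans (le_add_of_nonneg_right (hB0 n 0))) (hr n).le
  refine ⟨_, _, hg, hh, ?_, fun x _ => ?_, fun x hx => ?_, fun n x hx => ?_⟩
  · ext x
    refine ⟨fun hx => ?_, fun hx => ?_⟩
    · by_contra hxV
      exact hx (by simp [hoff _ x hxV])
    · obtain ⟨n, hn⟩ := hφpos x hx
      exact ((hsummable x).tsum_pos (fun n => hterm n x) n (mul_pos (hr n) hn)).ne'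
  · rw [← tsum_mul_left]
    exact tsum_congr fun n => mul_left_comm _ _ _
  · simp [hoff _ x hx]
  · rw [iteratedDeriv, iteratedDeriv, hg' n x hx, hh' n x hx]
    exact ⟨rfl, rfl⟩
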